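/- Let J be a real analytic almost complex structure on a neighborhood of 0 in ℝ^{2n} and let X be a real analytic vector field commuting at order k at 0, where k ≥ 2. Then for all X₁,…,X_k ∈ {X, JX}, [X₁,[X₂,[…,[X_k,[X,JX]]…]]](0) = [JX,[…,[JX,[X,[…,[X,[X,JX]]…]]…]]](0), where on the right-hand side JX appears q times and then X appears p times, with p = #{i : X_i = X} and q = #{i : X_i = JX}. -/

import Mathlib

noncomputable section

open Metric

/-- `ℝ^{2n}` identified with `ℂ^n`. -/
abbrev Ecx (n : ℕ) := EuclideanSpace ℂ (Fin n)

/-- The standard complex structure `J₀` (multiplication by `i`), as a real-linear map. -/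
def J0 (n : ℕ) : Ecx n →L[ℝ] Ecx n := Complex.I • ContinuousLinearMap.id ℝ (Ecx n)

variable {F : Type*} [NormedAddCommGroup F] [NormedSpace ℝ F]

/-- `J`-holomorphy of `γ` on a set `D ⊆ ℂ`: `dγ(ζ) ∘ J_st = J(γ ζ) ∘ dγ(ζ)`. -/
def JHolOn (J : F → F →L[ℝ] F) (D : Set ℂ) (γ : ℂ → F) : Prop :=
  ∀ ζ ∈ D, ∀ v : ℂ, fderiv ℝ γ ζ (Complex.I * v) = J (γ ζ) (fderiv ℝ γ ζ v)


/-- Lie bracket of vector fields: `[X,Y](p) = dY(p)(X(p)) − dX(p)(Y(p))`. -/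
def lieVF (X Y : F → F) : F → F :=
  fun p => fderiv ℝ Y p (X p) - fderiv ℝ X p (Y p)

/-- The vector field `JX : x ↦ J(x) X(x)`. -/
def Jvf (J : F → F →L[ℝ] F) (X : F → F) : F → F := fun p => J p (X p)

/-- The flat covariant derivative `X · Y : p ↦ dY(p)(X(p))`. -/
def derVF (X Y : F → F) : F → F := fun p => fderiv ℝ Y p (X p)

/-- `DX X Y k = D_X^{k,0} Y = X·(X·(⋯(X·Y)))` (`k` times). -/
def DX (X Y : F → F) : ℕ → (F → F)
  | 0 => Y
  | k + 1 => derVF X (DX X Y k)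

/-- `applyVF [X₁,…,X_k] Z = X₁·(X₂·(⋯(X_k·Z)))`. -/
def applyVF : List (F → F) → (F → F) → (F → F)
  | [], Z => Z
  | Y :: rest, Z => derVF Y (applyVF rest Z)

/-- `nestedLie [X₁,…,X_k] Z = [X₁,[X₂,[…,[X_k, Z]…]]]`. -/
def nestedLie : List (F → F) → (F → F) → (F → F)
  | [], Z => Z
  | Y :: rest, Z => lieVF Y (nestedLie rest Z)

/-- Selector for elements of `{X, JX}`: `pickVF X JX true = X`, `pickVF X JX false = JX`. -/
def pickVF (X Y : F → F) (b : Bool) : F → F := if b then X else Y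

/-- `X` commutes at order `k` at `p`: all iterated Lie brackets of length `l` with
`2 ≤ l ≤ k` of elements of `{X, JX}` vanish at `p`. -/
def CommutesAtOrder (J : F → F →L[ℝ] F) (X : F → F) (k : ℕ) (p : F) : Prop :=
  ∀ m : ℕ, 1 ≤ m → m + 1 ≤ k → ∀ b : Fin m → Bool, ∀ c : Bool,
    nestedLie (List.ofFn fun i => pickVF X (Jvf J X) (b i))
      (pickVF X (Jvf J X) c) p = 0

open VectorField
open scoped Topology ContDiff

lemma nestedLie_append (L M : List (F → F)) (Z : F → F) :
    nestedLie (L ++ M) Z = nestedLie L (nestedLie M Z) := by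
  induction L with
  | nil => rfl
  | cons Y L ih => simp only [List.cons_append, nestedLie, ih]

lemma ContDiffAt.lieVF {X Y : F → F} {p : F} (hX : ContDiffAt ℝ ω X p)
    (hY : ContDiffAt ℝ ω Y p) : ContDiffAt ℝ ω (lieVF X Y) p :=
  ContDiffAt.lieBracket_vectorField hX hY le_top

lemma ContDiffAt.nestedLie {L : List (F → F)} {Z : F → F} {p : F}
    (hL : ∀ Y ∈ L, ContDiffAt ℝ ω Y p) (hZ : ContDiffAt ℝ ω Z p) :
    ContDiffAt ℝ ω (nestedLie L Z) p := by
  induction L with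
  | nil => exact hZ
  | cons Y L ih =>
    exact (hL Y (by simp)).lieVF (ih fun W hW => hL W (by simp [hW]))

lemma Filter.EventuallyEq.nestedLie (L : List (F → F)) {Z W : F → F} {p : F}
    (h : Z =ᶠ[𝓝 p] W) : nestedLie L Z =ᶠ[𝓝 p] nestedLie L W := by
  induction L with
  | nil => exact h
  | cons Y L ih => exact Filter.EventuallyEq.rfl.lieBracket_vectorField ih

lemma ContDiffAt.eventually_omega {X : F → F} {p : F} (hX : ContDiffAt ℝ ω X p) :
    ∀ᶠ q in 𝓝 p, ContDiffAt ℝ ω X q :=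
  hX.eventually (by simp)

lemma nestedLie_add {L : List (F → F)} {Z W : F → F} {p : F}
    (hL : ∀ Y ∈ L, ContDiffAt ℝ ω Y p) (hZ : ContDiffAt ℝ ω Z p) (hW : ContDiffAt ℝ ω W p) :
    nestedLie L (Z + W) =ᶠ[𝓝 p] nestedLie L Z + nestedLie L W := by
  induction L with
  | nil => exact Filter.EventuallyEq.rfl
  | cons Y L ih =>
    have hL' : ∀ V ∈ L, ContDiffAt ℝ ω V p := fun V hV => hL V (by simp [hV])
    refine (Filter.EventuallyEq.rfl.lieBracket_vectorField (ih hL')).trans ?_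
    filter_upwards [(ContDiffAt.nestedLie hL' hZ).eventually_omega,
      (ContDiffAt.nestedLie hL' hW).eventually_omega] with q hq hq'
    exact lieBracket_add_right (hq.differentiableAt (by simp)) (hq'.differentiableAt (by simp))

lemma lieVF_lieVF [CompleteSpace F] {X Y Z : F → F} {p : F} (hX : ContDiffAt ℝ ω X p)
    (hY : ContDiffAt ℝ ω Y p) (hZ : ContDiffAt ℝ ω Z p) :
    lieVF X (lieVF Y Z) =ᶠ[𝓝 p] lieVF (lieVF X Y) Z + lieVF Y (lieVF X Z) := by
  filter_upwards [hX.eventually_omega, hY.eventually_omega, hZ.eventually_omega] with q h1 h2 h3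
  exact leibniz_identity_lieBracket (n := ω) le_top h1 h2 h3

/-- By the Leibniz rule, `[Y₁,[…,[Y_m,[P,Q]]…]]` vanishes at `p` as soon as the iterated brackets
of `P`, and those of `Q`, with at most `m` of the fields involved vanish at `p`. -/
lemma nestedLie_lieVF_eq_zero [CompleteSpace F] {S : Set (F → F)} {p : F}
    (hS : ∀ Y ∈ S, ContDiffAt ℝ ω Y p) (L : List (F → F)) (hL : ∀ Y ∈ L, Y ∈ S) {P Q : F → F}
    (hP : ContDiffAt ℝ ω P p) (hQ : ContDiffAt ℝ ω Q p)
    (hP0 : ∀ M : List (F → F), (∀ Y ∈ M, Y ∈ S) → M.length ≤ L.length → nestedLie M P p = 0)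
    (hQ0 : ∀ M : List (F → F), (∀ Y ∈ M, Y ∈ S) → M.length ≤ L.length → nestedLie M Q p = 0) :
    nestedLie L (lieVF P Q) p = 0 := by
  induction L using List.reverseRecOn generalizing P Q with
  | nil =>
    exact lieBracket_eq_zero_of_eq_zero (hP0 [] (by simp) le_rfl) (hQ0 [] (by simp) le_rfl)
  | append_singleton L Y ih =>
    have hY : Y ∈ S := hL Y (by simp)
    have hL' : ∀ V ∈ L, V ∈ S := fun V hV => hL V (by simp [hV])
    have hYd := hS Y hY
    have weaken : ∀ R : F → F, (∀ M : List (F → F), (∀ Y ∈ M, Y ∈ S) →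
        M.length ≤ (L ++ [Y]).length → nestedLie M R p = 0) →
        ∀ M : List (F → F), (∀ Y ∈ M, Y ∈ S) → M.length ≤ L.length → nestedLie M R p = 0 :=
      fun R hR M hM hl => hR M hM (by simp; omega)
    have bracket : ∀ R : F → F, (∀ M : List (F → F), (∀ Y ∈ M, Y ∈ S) →
        M.length ≤ (L ++ [Y]).length → nestedLie M R p = 0) →
        ∀ M : List (F → F), (∀ Y ∈ M, Y ∈ S) → M.length ≤ L.length →
          nestedLie M (lieVF Y R) p = 0 := fun R hR M hM hl => by
      have := hR (M ++ [Y]) (by simpa [or_imp, forall_and, hY] using hM) (by simpa using hl)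
      rwa [nestedLie_append] at this
    rw [nestedLie_append]
    change nestedLie L (lieVF Y (lieVF P Q)) p = 0
    rw [((lieVF_lieVF hYd hP hQ).nestedLie L).eq_of_nhds,
      (nestedLie_add (fun V hV => hS V (hL' V hV)) ((hYd.lieVF hP).lieVF hQ)
        (hP.lieVF (hYd.lieVF hQ))).eq_of_nhds, Pi.add_apply,
      ih hL' (hYd.lieVF hP) hQ (bracket P hP0) (weaken Q hQ0),
      ih hL' hP (hYd.lieVF hQ) (weaken P hP0) (bracket Q hQ0), add_zero]

/-- If all iterated brackets of length between `2` and `k` of fields in `S` vanish at `p`, then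
`[Y₁,[…,[Y_k,[A,B]]…]]` at `p` does not depend on the order of the `Yᵢ`. -/
lemma nestedLie_eq_of_perm [CompleteSpace F] {S : Set (F → F)} {p : F} {k : ℕ}
    (hS : ∀ Y ∈ S, ContDiffAt ℝ ω Y p)
    (hvan : ∀ M : List (F → F), (∀ Y ∈ M, Y ∈ S) → ∀ Z ∈ S, 1 ≤ M.length → M.length + 1 ≤ k →
      nestedLie M Z p = 0)
    {A B : F → F} (hA : A ∈ S) (hB : B ∈ S) {L L' : List (F → F)} (h : L.Perm L')
    (hL : ∀ Y ∈ L, Y ∈ S) (N : List (F → F)) (hN : ∀ Y ∈ N, Y ∈ S)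
    (hk : N.length + L.length ≤ k) :
    nestedLie (N ++ L) (lieVF A B) p = nestedLie (N ++ L') (lieVF A B) p := by
  induction h generalizing N with
  | nil => rfl
  | cons Y _ ih =>
    have := ih (fun V hV => hL V (by simp [hV])) (N ++ [Y])
      (by simpa [or_imp, forall_and, hL Y (by simp)] using hN)
      (by simp at hk ⊢; omega)
    simpa using this
  | swap Y Z L =>
    have hY : Y ∈ S := hL Y (by simp)
    have hZ : Z ∈ S := hL Z (by simp)
    have hL' : ∀ V ∈ L, V ∈ S := fun V hV => hL V (by simp [hV])
    have hW : ContDiffAt ℝ ω (nestedLie L (lieVF A B)) p :=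
      ContDiffAt.nestedLie (fun V hV => hS V (hL' V hV)) ((hS A hA).lieVF (hS B hB))
    simp only [List.length_cons] at hk
    rw [nestedLie_append, nestedLie_append]
    change nestedLie N (lieVF Z (lieVF Y _)) p = nestedLie N (lieVF Y (lieVF Z _)) p
    rw [((lieVF_lieVF (hS Z hZ) (hS Y hY) hW).nestedLie N).eq_of_nhds,
      (nestedLie_add (fun V hV => hS V (hN V hV)) (((hS Z hZ).lieVF (hS Y hY)).lieVF hW)
        ((hS Y hY).lieVF ((hS Z hZ).lieVF hW))).eq_of_nhds, Pi.add_apply, add_eq_right]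
    refine nestedLie_lieVF_eq_zero hS N hN ((hS Z hZ).lieVF (hS Y hY)) hW
      (fun M hM hl => ?_) (fun M hM hl => ?_)
    · have := hvan (M ++ [Z]) (by simpa [or_imp, forall_and, hZ] using hM) Y hY (by simp)
        (by simp; omega)
      rwa [nestedLie_append] at this
    · have := hvan (M ++ L ++ [A])
        (by simp only [List.mem_append, List.mem_singleton]; rintro V ((h | h) | rfl)
            exacts [hM V h, hL' V h, hA]) B hB (by simp; omega)
        (by simp; omega)
      rwa [nestedLie_append, nestedLie_append] at this
  | trans h₁ _ ih₁ ih₂ =>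
    exact (ih₁ hL N hN hk).trans
      (ih₂ (fun V hV => hL V (h₁.mem_iff.2 hV)) N hN (by rwa [← h₁.length_eq]))

lemma List.count_true_ofFn {k : ℕ} (b : Fin k → Bool) :
    (List.ofFn b).count true = (Finset.univ.filter fun i => b i = true).card := by
  induction k with
  | zero => simp
  | succ k ih =>
    rw [List.ofFn_succ, List.count_cons, ih, Fin.card_filter_univ_succ]
    cases b 0 <;> simp [add_comm]

lemma List.ofFn_perm_replicate_append {k : ℕ} (b : Fin k → Bool) :
    (List.ofFn b).Perm
      (List.replicate (k - (Finset.univ.filter fun i => b i = true).card) false ++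
        List.replicate (Finset.univ.filter fun i => b i = true).card true) := by
  have h := List.count_true_add_count_false (List.ofFn b)
  rw [List.length_ofFn, List.count_true_ofFn] at h
  rw [List.perm_iff_count]
  rintro (_ | _)
  · simp [List.count_append, List.count_replicate]
    omega
  · simp [List.count_append, List.count_replicate, List.count_true_ofFn]

/-- Proposition 4.3: brackets with `[X,JX]` can be reordered. -/
theorem stmt10 (n : ℕ) (U : Set (Ecx n)) (hU : IsOpen U) (h0U : (0 : Ecx n) ∈ U)
    (J : Ecx n → Ecx n →L[ℝ] Ecx n) (hJan : AnalyticOnNhd ℝ J U)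
    (hJsq : ∀ x ∈ U, (J x).comp (J x) = -ContinuousLinearMap.id ℝ (Ecx n))
    (X : Ecx n → Ecx n) (hXan : AnalyticOnNhd ℝ X U)
    (k : ℕ) (hk : 2 ≤ k) (hcomm : CommutesAtOrder J X k 0) :
    ∀ b : Fin k → Bool,
      nestedLie (List.ofFn fun i => pickVF X (Jvf J X) (b i)) (lieVF X (Jvf J X)) 0 =
      nestedLie
        (List.replicate (k - (Finset.univ.filter fun i => b i = true).card) (Jvf J X) ++
          List.replicate ((Finset.univ.filter fun i => b i = true).card) X)
        (lieVF X (Jvf J X)) 0 := by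
  intro b
  set A := Jvf J X
  have hXd : ContDiffAt ℝ ω X 0 := (hXan 0 h0U).contDiffAt
  have hAd : ContDiffAt ℝ ω A 0 := (hJan 0 h0U).contDiffAt.clm_apply hXd
  have lift : ∀ M : List (Ecx n → Ecx n), (∀ Y ∈ M, Y ∈ Set.range (pickVF X A)) →
      ∃ w : List Bool, w.map (pickVF X A) = M := fun M hM => by
    rwa [← Set.mem_range, Set.range_list_map]
  have key := nestedLie_eq_of_perm (S := Set.range (pickVF X A)) (p := 0) (k := k)
    (by rintro _ ⟨_ | _, rfl⟩ <;> simpa [pickVF])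
    (fun M hM Z hZ h1 h2 => by
      obtain ⟨w, rfl⟩ := lift M hM
      obtain ⟨c, rfl⟩ := hZ
      rw [List.length_map] at h1 h2
      have := hcomm w.length h1 h2 w.get c
      rwa [List.ofFn_comp' w.get (pickVF X A), List.ofFn_get] at this)
    (A := X) (B := A) ⟨true, rfl⟩ ⟨false, rfl⟩
    ((List.ofFn_perm_replicate_append b).map (pickVF X A))
    (fun Y hY => (List.mem_map.1 hY).imp fun _ h => h.2) [] (by simp) (by simp)
  simpa [List.map_ofFn, Function.comp_def, pickVF] using key
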